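/- Let H_1, H_2 be hyperplanes of T, and let a, b ∈ V' with r·a ∉ H_1 and r·b ∉ H_2, such that C(H_1,a) and C(H_2,b) are distinct classes (i.e., C(H_1,a) ≠ C(H_2,b)). If the vertices [a] and [b] are non-adjacent in the complement of X(2e,K) (i.e., a M bᵀ ≠ 0), then they have exactly (q^{2e-2}−1)·q^{2e-3}/(q−1) common neighbours in the complement of X(2e,K); if [a] and [b] are adjacent in the complement of X(2e,K) (i.e., a M bᵀ = 0), then they have exactly (q^{2e-2}−1)·q^{2e-3}/(q−1) − 2 common neighbours in the complement of X(2e,K). -/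

import Mathlib

open Matrix

/-- The symplectic form `a M bᵀ` where `M = [[0, Iₑ],[-Iₑ, 0]]`. -/
def sympForm (K : Type) [CommRing K] (e : ℕ) (a b : Fin e ⊕ Fin e → K) : K :=
  a ⬝ᵥ ((Matrix.fromBlocks (0 : Matrix (Fin e) (Fin e) K) 1 (-1) 0) *ᵥ b)

/-- `V'`: the set of 2e-tuples over `K` having at least one unit entry. -/
def unitTuples (K : Type) [CommRing K] (e : ℕ) : Set (Fin e ⊕ Fin e → K) :=
  {a | ∃ i, IsUnit (a i)}

/-- The equivalence class `[a]` of a tuple under unit scaling. -/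
def cls (K : Type) [CommRing K] (e : ℕ) (a : Fin e ⊕ Fin e → K) :
    Set (Fin e ⊕ Fin e → K) :=
  {b | ∃ σ : Kˣ, b = σ • a}

/-- `V`: the set of equivalence classes of elements of `V'` under unit scaling. -/
def classes (K : Type) [CommRing K] (e : ℕ) : Set (Set (Fin e ⊕ Fin e → K)) :=
  {S | ∃ a ∈ unitTuples K e, S = cls K e a}

/-- Adjacency in the graph `X(2e,K)`: `a M bᵀ ∈ K \ {0}`. -/
def adjX (K : Type) [CommRing K] (e : ℕ) (A B : Set (Fin e ⊕ Fin e → K)) : Prop :=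
  ∃ a ∈ A, ∃ b ∈ B, sympForm K e a b ≠ 0

/-- Adjacency in the complement of `X(2e,K)`: distinct classes with `a M bᵀ = 0`. -/
def adjXc (K : Type) [CommRing K] (e : ℕ) (A B : Set (Fin e ⊕ Fin e → K)) : Prop :=
  A ≠ B ∧ ∃ a ∈ A, ∃ b ∈ B, sympForm K e a b = 0

/-- Adjacency in the graph `Y(2e,K)`: `a M bᵀ ∈ J \ {0}`. -/
def adjY (K : Type) [CommRing K] (J : Ideal K) (e : ℕ)
    (A B : Set (Fin e ⊕ Fin e → K)) : Prop :=
  ∃ a ∈ A, ∃ b ∈ B, sympForm K e a b ∈ J ∧ sympForm K e a b ≠ 0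

/-- `T = J × ⋯ × J` (2e factors), as a subset of `K^{2e}`. -/
def Tset (K : Type) [CommRing K] (J : Ideal K) (e : ℕ) : Set (Fin e ⊕ Fin e → K) :=
  {x | ∀ i, x i ∈ J}

/-- A hyperplane of `T`: a `K`-submodule contained in `T` of cardinality `q^(2e-1)`. -/
def IsHyperplane (K : Type) [CommRing K] (J : Ideal K) (e q : ℕ)
    (H : Submodule K (Fin e ⊕ Fin e → K)) : Prop :=
  (H : Set (Fin e ⊕ Fin e → K)) ⊆ Tset K J e ∧ Nat.card H = q ^ (2 * e - 1)

/-- `C(H,u) = {[u+h] : h ∈ H}`. -/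
def classSet (K : Type) [CommRing K] (e : ℕ) (H : Submodule K (Fin e ⊕ Fin e → K))
    (u : Fin e ⊕ Fin e → K) : Set (Set (Fin e ⊕ Fin e → K)) :=
  {S | ∃ h ∈ (H : Set (Fin e ⊕ Fin e → K)), S = cls K e (u + h)}

/-- The set of tuples `{σ • (u+h) : σ ∈ Kˣ, h ∈ H}`. -/
def orbitSet (K : Type) [CommRing K] (e : ℕ) (H : Submodule K (Fin e ⊕ Fin e → K))
    (u : Fin e ⊕ Fin e → K) : Set (Fin e ⊕ Fin e → K) :=
  {x | ∃ σ : Kˣ, ∃ h ∈ (H : Set (Fin e ⊕ Fin e → K)), x = σ • (u + h)}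

/-- The coset `c • u + T` of `T`. -/
def cosetOf (K : Type) [CommRing K] (J : Ideal K) (e : ℕ) (c : K)
    (u : Fin e ⊕ Fin e → K) : Set (Fin e ⊕ Fin e → K) :=
  {x | ∃ t ∈ Tset K J e, x = c • u + t}

section LocalRing

variable {K : Type} [CommRing K] {J : Ideal K} {r : K}

lemma isUnit_iff_notMem_of_ideals (hJtop : J ≠ ⊤)
    (hideals : ∀ I : Ideal K, I = ⊥ ∨ I = J ∨ I = ⊤) (x : K) : IsUnit x ↔ x ∉ J := by
  refine ⟨fun h hx => hJtop (Ideal.eq_top_of_isUnit_mem J hx h), fun hx => ?_⟩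
  rcases hideals (Ideal.span {x}) with h | h | h
  · rw [Ideal.span_singleton_eq_bot] at h
    exact absurd (h ▸ J.zero_mem) hx
  · exact absurd (h ▸ Ideal.mem_span_singleton_self x) hx
  · exact Ideal.span_singleton_eq_top.mp h

/-- The annihilator of a generator of the unique non-trivial ideal is that ideal. -/
lemma mul_generator_eq_zero_iff (hJr : J = Ideal.span {r}) (hJbot : J ≠ ⊥) (hJtop : J ≠ ⊤)
    (hideals : ∀ I : Ideal K, I = ⊥ ∨ I = J ∨ I = ⊤) (x : K) : r * x = 0 ↔ x ∈ J := by
  have hu := isUnit_iff_notMem_of_ideals hJtop hideals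
  have hr : r ∈ J := hJr ▸ Ideal.mem_span_singleton_self r
  have hr0 : r ≠ 0 := fun h => hJbot (by rw [hJr, h, Ideal.span_singleton_eq_bot])
  have cancel : ∀ y : K, r * y = 0 → y ∈ J := by
    intro y hy
    by_contra h
    exact hr0 (((hu y).2 h).mul_left_eq_zero.mp hy)
  have hrr : r * r = 0 := by
    rcases hideals (Ideal.span {r * r}) with h | h | h
    · rwa [Ideal.span_singleton_eq_bot] at h
    · rw [← h, Ideal.mem_span_singleton] at hr
      obtain ⟨c, hc⟩ := hr
      have h1 : 1 - r * c ∈ J := cancel _ (by linear_combination hc)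
      have h2 : r * c ∈ J := J.mul_mem_right c (hJr ▸ Ideal.mem_span_singleton_self r)
      exact absurd ((Ideal.eq_top_iff_one J).2 (by simpa using J.add_mem h1 h2)) hJtop
    · rw [Ideal.span_singleton_eq_top] at h
      exact absurd hr ((hu r).1 (isUnit_of_mul_isUnit_left h))
  refine ⟨cancel x, fun hx => ?_⟩
  rw [hJr, Ideal.mem_span_singleton] at hx
  obtain ⟨c, rfl⟩ := hx
  rw [← mul_assoc, hrr, zero_mul]

lemma mul_eq_zero_of_mem_generated (hJr : J = Ideal.span {r})
    (hann : ∀ x, r * x = 0 ↔ x ∈ J) {x y : K} (hx : x ∈ J) (hy : y ∈ J) : x * y = 0 := by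
  rw [hJr, Ideal.mem_span_singleton] at hx
  obtain ⟨c, rfl⟩ := hx
  rw [mul_right_comm, (hann y).2 hy, zero_mul]

/-- A finite module is the disjoint union of the fibres of an endomorphism. -/
lemma card_eq_card_ker_mul_card_range {M N : Type*} [AddCommGroup M] [Module K M]
    [AddCommGroup N] [Module K N] (f : M →ₗ[K] N) :
    Nat.card M = Nat.card (LinearMap.ker f) * Nat.card (LinearMap.range f) := by
  rw [Submodule.card_eq_card_quotient_mul_card (LinearMap.ker f),
    Nat.card_congr f.quotKerEquivRange.toEquiv]

lemma card_ideal_eq_card_quotient (hJr : J = Ideal.span {r})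
    (hann : ∀ x, r * x = 0 ↔ x ∈ J) : Nat.card J = Nat.card (K ⧸ J) := by
  have hker : LinearMap.ker (LinearMap.mulLeft K r) = J := by
    ext x; simp [hann]
  have hrange : LinearMap.range (LinearMap.mulLeft K r) = J := by
    ext x; simp [hJr, Ideal.mem_span_singleton, Dvd.dvd, eq_comm]
  have e := (LinearMap.mulLeft K r).quotKerEquivRange
  rw [hker, hrange] at e
  exact (Nat.card_congr e.toEquiv).symm

lemma card_ring_eq_sq (hJr : J = Ideal.span {r})
    (hann : ∀ x, r * x = 0 ↔ x ∈ J) : Nat.card K = Nat.card (K ⧸ J) ^ 2 := by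
  rw [Submodule.card_eq_card_quotient_mul_card J, card_ideal_eq_card_quotient hJr hann, sq]

lemma card_units_add_card_ideal [Finite K] (hu : ∀ x : K, IsUnit x ↔ x ∉ J) :
    Nat.card Kˣ + Nat.card J = Nat.card K := by
  have h1 : Nat.card Kˣ = ((J : Set K)ᶜ).ncard := by
    rw [← Nat.card_coe_set_eq]
    refine Nat.card_congr (Equiv.ofBijective (fun u => ⟨u, (hu u).1 u.isUnit⟩) ⟨?_, ?_⟩)
    · intro u v h
      exact Units.ext (congrArg Subtype.val h)
    · rintro ⟨x, hx⟩
      obtain ⟨u, rfl⟩ := (hu x).2 hx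
      exact ⟨u, rfl⟩
  have h2 : Nat.card J = (J : Set K).ncard := Nat.card_coe_set_eq _
  rw [h1, h2, add_comm, Set.ncard_add_ncard_compl]

end LocalRing

section Tuples

variable {K : Type} [CommRing K] {J : Ideal K} {r : K} {e : ℕ}

lemma mem_cls_self (a : Fin e ⊕ Fin e → K) : a ∈ cls K e a := ⟨1, by simp⟩

lemma cls_smul (u : Kˣ) (a : Fin e ⊕ Fin e → K) : cls K e (u • a) = cls K e a := by
  ext x
  constructor
  · rintro ⟨σ, rfl⟩
    exact ⟨σ * u, by rw [mul_smul]⟩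
  · rintro ⟨σ, rfl⟩
    exact ⟨σ * u⁻¹, by rw [mul_smul, inv_smul_smul]⟩

lemma cls_eq_iff {a b : Fin e ⊕ Fin e → K} : cls K e a = cls K e b ↔ ∃ u : Kˣ, b = u • a := by
  constructor
  · intro h
    have : b ∈ cls K e a := h ▸ mem_cls_self b
    exact this
  · rintro ⟨u, rfl⟩
    exact (cls_smul u a).symm

lemma smul_mem_unitTuples {a : Fin e ⊕ Fin e → K} (ha : a ∈ unitTuples K e) (u : Kˣ) :
    u • a ∈ unitTuples K e := by
  obtain ⟨i, hi⟩ := ha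
  refine ⟨i, ?_⟩
  rw [Pi.smul_apply, Units.smul_def, smul_eq_mul]
  exact u.isUnit.mul hi

lemma smul_left_injective_of_mem_unitTuples {a : Fin e ⊕ Fin e → K}
    (ha : a ∈ unitTuples K e) {u v : Kˣ} (h : u • a = v • a) : u = v := by
  obtain ⟨i, hi⟩ := ha
  have := congrFun h i
  simp only [Pi.smul_apply, Units.smul_def, smul_eq_mul] at this
  exact Units.ext (hi.mul_right_cancel this)

lemma notMem_unitTuples_iff (hu : ∀ x : K, IsUnit x ↔ x ∉ J) (a : Fin e ⊕ Fin e → K) :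
    a ∉ unitTuples K e ↔ a ∈ Tset K J e := by
  simp [unitTuples, Tset, hu]

lemma smul_eq_zero_iff_mem_Tset (hann : ∀ x, r * x = 0 ↔ x ∈ J) (a : Fin e ⊕ Fin e → K) :
    r • a = 0 ↔ a ∈ Tset K J e := by
  simp [funext_iff, Tset, hann]

lemma sympForm_eq_sum (a b : Fin e ⊕ Fin e → K) :
    sympForm K e a b =
      ∑ i, (a (Sum.inl i) * b (Sum.inr i) - a (Sum.inr i) * b (Sum.inl i)) := by
  rw [Finset.sum_sub_distrib, sub_eq_add_neg]
  simp [sympForm, dotProduct, Matrix.fromBlocks_mulVec, Matrix.neg_mulVec]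

lemma sympForm_smul_smul (u v : K) (a b : Fin e ⊕ Fin e → K) :
    sympForm K e (u • a) (v • b) = u * v * sympForm K e a b := by
  simp only [sympForm_eq_sum, Pi.smul_apply, smul_eq_mul, Finset.mul_sum]
  exact Finset.sum_congr rfl fun i _ => by ring

lemma sympForm_self (a : Fin e ⊕ Fin e → K) : sympForm K e a a = 0 := by
  rw [sympForm_eq_sum]
  exact Finset.sum_eq_zero fun i _ => by ring

lemma sympForm_swap (a b : Fin e ⊕ Fin e → K) : sympForm K e a b = -sympForm K e b a := by
  simp only [sympForm_eq_sum, ← Finset.sum_neg_distrib]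
  exact Finset.sum_congr rfl fun i _ => by ring

lemma adjXc_cls_iff (x a : Fin e ⊕ Fin e → K) :
    adjXc K e (cls K e x) (cls K e a) ↔ cls K e x ≠ cls K e a ∧ sympForm K e x a = 0 := by
  refine and_congr_right fun _ => ⟨?_, fun h => ⟨x, mem_cls_self x, a, mem_cls_self a, h⟩⟩
  rintro ⟨_, ⟨σ, rfl⟩, _, ⟨τ, rfl⟩, h⟩
  rw [Units.smul_def, Units.smul_def, sympForm_smul_smul] at h
  exact ((σ.isUnit.mul τ.isUnit).mul_right_eq_zero).mp h

/-- The pair of functionals `x ↦ (x M aᵀ, x M bᵀ)`. -/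
def sympPair (a b : Fin e ⊕ Fin e → K) : (Fin e ⊕ Fin e → K) →ₗ[K] K × K where
  toFun x := (sympForm K e x a, sympForm K e x b)
  map_add' x y := by simp [sympForm, add_dotProduct]
  map_smul' c x := by simp [sympForm, smul_dotProduct]

lemma mem_ker_sympPair {a b x : Fin e ⊕ Fin e → K} :
    x ∈ LinearMap.ker (sympPair a b) ↔ sympForm K e x a = 0 ∧ sympForm K e x b = 0 :=
  Prod.mk_eq_zero

/-- Every coordinate functional is represented by the symplectic form. -/
lemma exists_sympForm_eq_apply (i : Fin e ⊕ Fin e) :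
    ∃ x : Fin e ⊕ Fin e → K, ∀ b, sympForm K e x b = b i := by
  rcases i with i | i
  · exact ⟨-Pi.single (Sum.inr i) 1, fun b => by
      simp [sympForm, neg_dotProduct, Matrix.fromBlocks_mulVec, Matrix.neg_mulVec]⟩
  · exact ⟨Pi.single (Sum.inl i) 1, fun b => by
      simp [sympForm, Matrix.fromBlocks_mulVec]⟩

lemma sympPair_surjective_of_minor {a b : Fin e ⊕ Fin e → K} {i j : Fin e ⊕ Fin e}
    (h : IsUnit (a i * b j - a j * b i)) : Function.Surjective (sympPair a b) := by
  obtain ⟨x, hx⟩ := exists_sympForm_eq_apply (K := K) i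
  obtain ⟨y, hy⟩ := exists_sympForm_eq_apply (K := K) j
  obtain ⟨d, hd⟩ := h.exists_left_inv
  rintro ⟨c₁, c₂⟩
  have ex : sympPair a b x = (a i, b i) := Prod.ext (hx a) (hx b)
  have ey : sympPair a b y = (a j, b j) := Prod.ext (hy a) (hy b)
  refine ⟨(d * (c₁ * b j - c₂ * a j)) • x + (d * (c₂ * a i - c₁ * b i)) • y, ?_⟩
  rw [map_add, map_smul, map_smul, ex, ey]
  refine Prod.ext ?_ ?_
  · simp only [Prod.fst_add, Prod.smul_fst, smul_eq_mul]
    linear_combination c₁ * hd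
  · simp only [Prod.snd_add, Prod.smul_snd, smul_eq_mul]
    linear_combination c₂ * hd

/-- Two unit tuples are proportional modulo `J`, or some minor of them is a unit. -/
lemma exists_sub_mem_Tset_or_exists_minor (hu : ∀ x : K, IsUnit x ↔ x ∉ J)
    {a b : Fin e ⊕ Fin e → K} (ha : a ∈ unitTuples K e) (hb : b ∈ unitTuples K e) :
    (∃ σ : Kˣ, b - σ • a ∈ Tset K J e) ∨ ∃ i j, IsUnit (a i * b j - a j * b i) := by
  by_cases hm : ∃ i j, IsUnit (a i * b j - a j * b i)
  · exact Or.inr hm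
  left
  push Not at hm
  simp only [hu, not_not] at hm
  obtain ⟨i, α, hα⟩ := ha
  have key : ∀ j, b j - (α⁻¹ : Kˣ) * b i * a j ∈ J := by
    intro j
    have := J.mul_mem_left (α⁻¹ : Kˣ) (hm i j)
    rw [← hα] at this
    convert this using 1
    linear_combination (-b j) * α.inv_mul
  have hbi : IsUnit (b i) := by
    rw [hu]
    intro hbi
    refine (notMem_unitTuples_iff hu b).2 (fun j => ?_) hb
    have := J.add_mem (key j) (J.mul_mem_left ((α⁻¹ : Kˣ) * a j) hbi)
    convert this using 1
    ring
  obtain ⟨β, hβ⟩ := hbi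
  refine ⟨α⁻¹ * β, fun j => ?_⟩
  simpa [Units.smul_def, hβ] using key j

lemma card_Tset : Nat.card (Tset K J e) = Nat.card J ^ (2 * e) := by
  have h : Nat.card (Tset K J e) = Nat.card (Fin e ⊕ Fin e → J) :=
    Nat.card_congr (Equiv.subtypePiEquivPi (p := fun (_ : Fin e ⊕ Fin e) (x : K) => x ∈ J))
  rw [h, Nat.card_fun]
  simp [two_mul]

/-- The class of a hyperplane and a tuple does not depend on the hyperplane. -/
lemma classSet_eq [Finite K] (hJr : J = Ideal.span {r}) (hu : ∀ x : K, IsUnit x ↔ x ∉ J)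
    (hann : ∀ x, r * x = 0 ↔ x ∈ J) (he : 0 < e)
    {H : Submodule K (Fin e ⊕ Fin e → K)} (hH : IsHyperplane K J e (Nat.card J) H)
    {a : Fin e ⊕ Fin e → K} (hra : r • a ∉ H) :
    classSet K e H a = {S | ∃ t ∈ Tset K J e, S = cls K e (a + t)} := by
  obtain ⟨hHT, hHcard⟩ := hH
  apply Set.Subset.antisymm
  · rintro S ⟨h, hh, rfl⟩
    exact ⟨h, hHT hh, rfl⟩
  let f : H × J → Tset K J e := fun p =>
    ⟨p.1 + (p.2 : K) • a, fun i => J.add_mem (hHT p.1.2 i) (J.mul_mem_right (a i) p.2.2)⟩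
  have hf : Function.Injective f := by
    rintro ⟨⟨h, hh⟩, ⟨j, hj⟩⟩ ⟨⟨h', hh'⟩, ⟨j', hj'⟩⟩ heq
    have heq' : h + j • a = h' + j' • a := congrArg Subtype.val heq
    have hd : (j - j') • a ∈ H := by
      have : (j - j') • a = h' - h := by
        rw [sub_smul, sub_eq_sub_iff_add_eq_add, add_comm, heq']
      exact this ▸ H.sub_mem hh' hh
    have hjj : j = j' := by
      have hm := J.sub_mem hj hj'
      rw [hJr, Ideal.mem_span_singleton] at hm
      obtain ⟨c, hc⟩ := hm
      by_cases hcJ : c ∈ J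
      · rw [(hann c).2 hcJ] at hc
        exact sub_eq_zero.mp hc
      · obtain ⟨d, hd'⟩ := ((hu c).2 hcJ).exists_right_inv
        refine absurd ?_ hra
        have := H.smul_mem d hd
        rwa [smul_smul, hc, show d * (r * c) = r by linear_combination r * hd'] at this
    subst hjj
    have : h = h' := by simpa using heq'
    subst this
    rfl
  have hcard : Nat.card (H × J) = Nat.card (Tset K J e) := by
    rw [Nat.card_prod, hHcard, card_Tset, ← pow_succ]
    congr 1
    omega
  have hbij := (Nat.bijective_iff_injective_and_card f).2 ⟨hf, hcard⟩
  rintro S ⟨t, ht, rfl⟩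
  obtain ⟨⟨⟨h, hh⟩, ⟨j, hj⟩⟩, hp⟩ := hbij.2 ⟨t, ht⟩
  have hp' : h + j • a = t := congrArg Subtype.val hp
  have hunit : IsUnit (1 + j) := by
    refine IsUnit.of_mul_eq_one (1 - j) ?_
    linear_combination -(mul_eq_zero_of_mem_generated hJr hann hj hj)
  obtain ⟨σ, hσ⟩ := hunit
  refine ⟨h, hh, ?_⟩
  rw [← cls_smul σ (a + h)]
  congr 1
  ext i
  have hz := mul_eq_zero_of_mem_generated hJr hann hj (hHT hh i)
  simp only [← hp', Units.smul_def, hσ, Pi.add_apply, Pi.smul_apply, smul_eq_mul]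
  linear_combination -hz

lemma classes_mod_eq {a b : Fin e ⊕ Fin e → K} {σ : Kˣ} (h : b - σ • a ∈ Tset K J e) :
    {S | ∃ t ∈ Tset K J e, S = cls K e (a + t)} =
      {S | ∃ t ∈ Tset K J e, S = cls K e (b + t)} := by
  ext S
  constructor
  · rintro ⟨t, ht, rfl⟩
    refine ⟨σ • t - (b - σ • a), fun i => ?_, ?_⟩
    · exact J.sub_mem (J.mul_mem_left σ (ht i)) (h i)
    · rw [← cls_smul σ (a + t), smul_add]
      congr 1
      abel
  · rintro ⟨t, ht, rfl⟩
    refine ⟨σ⁻¹ • (t + (b - σ • a)), fun i => ?_, ?_⟩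
    · exact J.mul_mem_left (σ⁻¹ : Kˣ) (J.add_mem (ht i) (h i))
    · rw [← cls_smul σ (a + _), smul_add, smul_inv_smul]
      congr 1
      abel

lemma card_ker_sympPair [Finite K] {a b : Fin e ⊕ Fin e → K}
    (hs : Function.Surjective (sympPair a b)) :
    Nat.card (LinearMap.ker (sympPair a b)) * Nat.card K ^ 2 = Nat.card K ^ (2 * e) := by
  have h := card_eq_card_ker_mul_card_range (sympPair a b)
  have h2 : Nat.card (LinearMap.range (sympPair a b)) = Nat.card K ^ 2 := by
    rw [LinearMap.range_eq_top.2 hs, Nat.card_congr Submodule.topEquiv.toEquiv, Nat.card_prod, sq]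
  rw [h2] at h
  rw [← h, Nat.card_fun]
  simp [two_mul]

lemma card_ker_sympPair_eq_sq (hJr : J = Ideal.span {r}) (hann : ∀ x, r * x = 0 ↔ x ∈ J)
    {a b : Fin e ⊕ Fin e → K} (hs : Function.Surjective (sympPair a b)) :
    Nat.card (LinearMap.ker (sympPair a b)) =
      ((LinearMap.ker (sympPair a b) : Set (Fin e ⊕ Fin e → K)) ∩ Tset K J e).ncard ^ 2 := by
  set S := LinearMap.ker (sympPair a b) with hS
  let f : S →ₗ[K] (Fin e ⊕ Fin e → K) := r • S.subtype
  have hker : Nat.card (LinearMap.ker f) =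
      ((S : Set (Fin e ⊕ Fin e → K)) ∩ Tset K J e).ncard := by
    rw [← Nat.card_coe_set_eq]
    refine Nat.card_congr ((Equiv.subtypeEquivRight fun x => ?_).trans
      (Equiv.subtypeSubtypeEquivSubtypeInter (· ∈ S) (· ∈ Tset K J e)))
    exact smul_eq_zero_iff_mem_Tset hann (x : Fin e ⊕ Fin e → K)
  have hrange : (LinearMap.range f : Set (Fin e ⊕ Fin e → K)) = (S : Set (Fin e ⊕ Fin e → K)) ∩ Tset K J e := by
    ext x
    constructor
    · rintro ⟨y, rfl⟩
      refine ⟨S.smul_mem r y.2, fun i => ?_⟩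
      exact J.mul_mem_right _ (hJr ▸ Ideal.mem_span_singleton_self r)
    · rintro ⟨hxS, hxT⟩
      have hdiv : ∀ z ∈ J, ∃ c, z = r * c := fun z hz => by
        rwa [hJr, Ideal.mem_span_singleton] at hz
      choose y hy using fun i => hdiv (x i) (hxT i)
      have hxy : x = r • y := funext hy
      have hxS' : sympPair a b x = 0 := hxS
      rw [hxy, map_smul] at hxS'
      obtain ⟨c₁, hc₁⟩ := hdiv _ ((hann _).1 (congrArg Prod.fst hxS'))
      obtain ⟨c₂, hc₂⟩ := hdiv _ ((hann _).1 (congrArg Prod.snd hxS'))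
      obtain ⟨w, hw⟩ := hs (c₁, c₂)
      refine ⟨⟨y - r • w, ?_⟩, ?_⟩
      · rw [hS, LinearMap.mem_ker, map_sub, map_smul, hw, sub_eq_zero]
        exact Prod.ext hc₁ hc₂
      · have hrr : r * r = 0 := (hann r).2 (hJr ▸ Ideal.mem_span_singleton_self r)
        change r • (y - r • w) = x
        rw [smul_sub, smul_smul, hrr, zero_smul, sub_zero, hxy]
  have hrange' : Nat.card (LinearMap.range f) =
      ((S : Set (Fin e ⊕ Fin e → K)) ∩ Tset K J e).ncard := by
    rw [← hrange]
    exact Nat.card_coe_set_eq _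
  rw [card_eq_card_ker_mul_card_range f, hker, hrange', sq]

/-- Unit scalars act freely on the unit tuples of a submodule. -/
lemma card_classes_mul_card_units (S : Submodule K (Fin e ⊕ Fin e → K)) :
    {C | ∃ x ∈ unitTuples K e, x ∈ S ∧ C = cls K e x}.ncard * Nat.card Kˣ =
      ((S : Set (Fin e ⊕ Fin e → K)) ∩ unitTuples K e).ncard := by
  rw [← Nat.card_coe_set_eq, ← Nat.card_coe_set_eq, ← Nat.card_prod]
  choose rep hrepU hrepS hrep using
    fun C : {C | ∃ x ∈ unitTuples K e, x ∈ S ∧ C = cls K e x} => C.2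
  refine Nat.card_congr (Equiv.ofBijective
    (fun p => ⟨p.2 • rep p.1, S.smul_mem (p.2 : K) (hrepS p.1),
      smul_mem_unitTuples (hrepU p.1) p.2⟩) ⟨?_, ?_⟩)
  · rintro ⟨C, u⟩ ⟨D, v⟩ h
    have h' : u • rep C = v • rep D := congrArg Subtype.val h
    have hCD : C = D := by
      apply Subtype.ext
      rw [hrep C, hrep D, ← cls_smul u (rep C), h', cls_smul]
    subst hCD
    rw [smul_left_injective_of_mem_unitTuples (hrepU C) h']
  · rintro ⟨x, hxS, hxU⟩
    let C : {C | ∃ x ∈ unitTuples K e, x ∈ S ∧ C = cls K e x} := ⟨cls K e x, x, hxU, hxS, rfl⟩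
    obtain ⟨u, hux⟩ := cls_eq_iff.1 (hrep C).symm
    exact ⟨(C, u), Subtype.ext hux.symm⟩

/-- The number of vertices orthogonal to two vertices independent modulo `J`. -/
lemma ncard_orthogonal_classes [Finite K] (hJr : J = Ideal.span {r})
    (hu : ∀ x : K, IsUnit x ↔ x ∉ J) (hann : ∀ x, r * x = 0 ↔ x ∈ J) {q : ℕ} (hq : 1 < q)
    (hqcard : Nat.card (K ⧸ J) = q) (he : 2 ≤ e) {a b : Fin e ⊕ Fin e → K}
    (hs : Function.Surjective (sympPair a b)) :
    {C | ∃ x ∈ unitTuples K e, x ∈ LinearMap.ker (sympPair a b) ∧ C = cls K e x}.ncard =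
      (q ^ (2 * e - 2) - 1) * q ^ (2 * e - 3) / (q - 1) := by
  obtain ⟨k, rfl⟩ := Nat.exists_eq_add_of_le he
  have hK : Nat.card K = q ^ 2 := hqcard ▸ card_ring_eq_sq hJr hann
  have hJ : Nat.card J = q := hqcard ▸ card_ideal_eq_card_quotient hJr hann
  have hU := card_units_add_card_ideal hu
  have hker := card_ker_sympPair hs
  have hsq := card_ker_sympPair_eq_sq hJr hann hs
  have hfree := card_classes_mul_card_units (LinearMap.ker (sympPair a b))
  set S := LinearMap.ker (sympPair a b)
  set N := {C | ∃ x ∈ unitTuples K (2 + k), x ∈ S ∧ C = cls K (2 + k) x}.ncard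
  have hsplit : ((S : Set (Fin (2 + k) ⊕ Fin (2 + k) → K)) ∩ Tset K J (2 + k)).ncard +
      ((S : Set (Fin (2 + k) ⊕ Fin (2 + k) → K)) ∩ unitTuples K (2 + k)).ncard = Nat.card S := by
    have hT : Tset K J (2 + k) = (unitTuples K (2 + k))ᶜ := by
      ext x
      exact (notMem_unitTuples_iff hu x).symm
    rw [hT, ← Set.sdiff_eq, add_comm]
    exact (Set.ncard_inter_add_ncard_sdiff_eq_ncard _ _ (Set.toFinite _)).trans
      (Nat.card_coe_set_eq _).symm
  set t := ((S : Set (Fin (2 + k) ⊕ Fin (2 + k) → K)) ∩ Tset K J (2 + k)).ncard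
  have hq0 : 0 < q := by omega
  have ht : t = q ^ (2 * k + 2) := by
    rw [hsq, hK] at hker
    have h1 : (t * q ^ 2) ^ 2 = (q ^ (2 * k + 2) * q ^ 2) ^ 2 := by
      rw [mul_pow, hker]
      ring
    exact Nat.eq_of_mul_eq_mul_right (by positivity) (Nat.pow_left_injective two_ne_zero h1)
  rw [hK, hJ] at hU
  rw [show 2 * (2 + k) - 2 = 2 * k + 2 by omega, show 2 * (2 + k) - 3 = 2 * k + 1 by omega]
  symm
  apply Nat.div_eq_of_eq_mul_left (by omega)
  rw [← hfree, hsq, ht] at hsplit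
  obtain ⟨p, rfl⟩ : ∃ p, q = p + 1 := ⟨q - 1, by omega⟩
  have hU' : Nat.card Kˣ = (p + 1) * p := by
    have : (p + 1) ^ 2 = (p + 1) * p + (p + 1) := by ring
    omega
  rw [hU'] at hsplit
  obtain ⟨m, hm⟩ : ∃ m, (p + 1) ^ (2 * k + 2) = m + 1 :=
    ⟨_, (Nat.sub_add_cancel (Nat.one_le_pow _ _ hq0)).symm⟩
  rw [hm, Nat.add_sub_cancel, Nat.add_sub_cancel]
  have h3 : (m + 1) + N * ((p + 1) * p) = (m + 1) + m * (m + 1) := by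
    rw [hm] at hsplit
    linarith [hsplit]
  have h4 := Nat.add_left_cancel h3
  have h5 : m + 1 = (p + 1) * (p + 1) ^ (2 * k + 1) := by
    rw [← hm]; ring
  refine Nat.eq_of_mul_eq_mul_left (Nat.succ_pos p) ?_
  calc (p + 1) * (m * (p + 1) ^ (2 * k + 1)) = m * (m + 1) := by rw [h5]; ring
    _ = (p + 1) * (N * p) := by rw [← h4]; ring

end Tuples

/-- Proposition: common neighbours in the complement of `X(2e,K)` of two vertices
from different classes of the partition. -/
theorem common_neighbours_complement_X_different_classes
    (K : Type) [CommRing K] [Fintype K]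
    (J : Ideal K) (r : K) (q : ℕ)
    (hJr : J = Ideal.span {r})
    (hJbot : J ≠ ⊥) (hJtop : J ≠ ⊤)
    (hideals : ∀ I : Ideal K, I = ⊥ ∨ I = J ∨ I = ⊤)
    (hq : IsPrimePow q)
    (hqcard : Nat.card (K ⧸ J) = q)
    (e : ℕ) (he : 2 ≤ e)
    (H₁ H₂ : Submodule K (Fin e ⊕ Fin e → K))
    (hH₁ : IsHyperplane K J e q H₁) (hH₂ : IsHyperplane K J e q H₂)
    (a b : Fin e ⊕ Fin e → K)
    (ha : a ∈ unitTuples K e) (hb : b ∈ unitTuples K e)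
    (hra : r • a ∉ H₁) (hrb : r • b ∉ H₂)
    (hCC : classSet K e H₁ a ≠ classSet K e H₂ b) :
    (sympForm K e a b ≠ 0 →
      Nat.card ↥{C ∈ classes K e | adjXc K e C (cls K e a) ∧ adjXc K e C (cls K e b)} =
        (q ^ (2 * e - 2) - 1) * q ^ (2 * e - 3) / (q - 1)) ∧
    (sympForm K e a b = 0 →
      Nat.card ↥{C ∈ classes K e | adjXc K e C (cls K e a) ∧ adjXc K e C (cls K e b)} =
        (q ^ (2 * e - 2) - 1) * q ^ (2 * e - 3) / (q - 1) - 2) := by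
  have hu := isUnit_iff_notMem_of_ideals hJtop hideals
  have hann := mul_generator_eq_zero_iff hJr hJbot hJtop hideals
  have hJ : Nat.card J = q := hqcard ▸ card_ideal_eq_card_quotient hJr hann
  have hprop : ¬∃ σ : Kˣ, b - σ • a ∈ Tset K J e := by
    rintro ⟨σ, hσ⟩
    rw [← hJ] at hH₁ hH₂
    refine hCC ?_
    rw [classSet_eq hJr hu hann (by omega) hH₁ hra, classSet_eq hJr hu hann (by omega) hH₂ hrb,
      classes_mod_eq hσ]
  have hs : Function.Surjective (sympPair a b) := by
    obtain h | ⟨i, j, hij⟩ := exists_sub_mem_Tset_or_exists_minor hu ha hb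
    · exact absurd h hprop
    · exact sympPair_surjective_of_minor hij
  have hab : cls K e a ≠ cls K e b := by
    intro h
    obtain ⟨σ, hσ⟩ := cls_eq_iff.1 h
    exact hprop ⟨σ, fun i => by simp [hσ]⟩
  have hN := ncard_orthogonal_classes hJr hu hann hq.one_lt hqcard he hs
  set P := {C | ∃ x ∈ unitTuples K e, x ∈ LinearMap.ker (sympPair a b) ∧ C = cls K e x}
  have hset : {C ∈ classes K e | adjXc K e C (cls K e a) ∧ adjXc K e C (cls K e b)} =
      P \ {cls K e a, cls K e b} := by
    ext C
    constructor
    · rintro ⟨⟨x, hx, rfl⟩, h₁, h₂⟩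
      rw [adjXc_cls_iff] at h₁ h₂
      refine ⟨⟨x, hx, mem_ker_sympPair.2 ⟨h₁.2, h₂.2⟩, rfl⟩, ?_⟩
      rintro (h | h)
      · exact h₁.1 h
      · exact h₂.1 h
    · rintro ⟨⟨x, hx, hxS, rfl⟩, hne⟩
      obtain ⟨h₁, h₂⟩ := mem_ker_sympPair.1 hxS
      refine ⟨⟨x, hx, rfl⟩, ?_⟩
      rw [adjXc_cls_iff, adjXc_cls_iff]
      exact ⟨⟨fun h => hne (Or.inl h), h₁⟩, ⟨fun h => hne (Or.inr h), h₂⟩⟩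
  rw [hset, Nat.card_coe_set_eq]
  constructor
  · intro hne
    rw [← hN]
    congr 1
    refine sdiff_eq_left.2 (Set.disjoint_left.2 ?_)
    rintro C ⟨x, -, hxS, rfl⟩ (h | h)
    all_goals
      obtain ⟨h₁, h₂⟩ := mem_ker_sympPair.1 hxS
      obtain ⟨σ, hσ⟩ := cls_eq_iff.1 h
      refine hne ?_
    · rw [hσ, ← one_smul K b, Units.smul_def, sympForm_smul_smul, h₂, mul_zero]
    · rw [sympForm_swap, hσ, ← one_smul K a, Units.smul_def, sympForm_smul_smul, h₁, mul_zero,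
        neg_zero]
  · intro h0
    have hsub : ({cls K e a, cls K e b} : Set (Set (Fin e ⊕ Fin e → K))) ⊆ P := by
      rintro C (rfl | rfl)
      · exact ⟨a, ha, mem_ker_sympPair.2 ⟨sympForm_self a, h0⟩, rfl⟩
      · exact ⟨b, hb, mem_ker_sympPair.2 ⟨by rw [sympForm_swap, h0, neg_zero], sympForm_self b⟩,
          rfl⟩
    rw [Set.ncard_sdiff hsub, hN, Set.ncard_pair hab]
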